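/- Let G be a directed cyclic graph containing a directed cycle C. Then the graph H = Reverse(G, C) is Markov equivalent to G. -/

import Mathlib

namespace CausalMEC

/-- A directed graph on `Fin n`, given by a Boolean edge function (`d a b = true` means `a → b`). -/
abbrev Dir (n : ℕ) := Fin n → Fin n → Bool

/-- Directed reachability (zero or more steps). -/
def Reach {n : ℕ} (d : Dir n) : Fin n → Fin n → Prop :=
  Relation.ReflTransGen fun a b => d a b = true

/-- No directed cycles (including no self-loops). -/
def Acyclic {n : ℕ} (d : Dir n) : Prop :=
  ∀ v, ¬ Relation.TransGen (fun a b => d a b = true) v v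

/-- A directed acyclic graph. -/
def IsDAG {n : ℕ} (d : Dir n) : Prop :=
  (∀ v, d v v = false) ∧ Acyclic d

/-- A directed (possibly cyclic) graph with edges between distinct vertices. -/
def IsDCG {n : ℕ} (d : Dir n) : Prop :=
  ∀ v, d v v = false

/-- The number of directed edges. -/
def edgeCount {n : ℕ} (d : Dir n) : ℕ :=
  (Finset.univ.filter fun q : Fin n × Fin n => d q.1 q.2 = true).card

/-- The parent set of a vertex. -/
def parents {n : ℕ} (d : Dir n) (v : Fin n) : Finset (Fin n) :=
  Finset.univ.filter fun u => d u v = true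

/-! ### Paths, d-connection and Markov equivalence in mixed graphs
A mixed graph is given by a directed part `d` and a bidirected part `b`. -/

/-- The kind of a step on a path: a directed edge traversed forwards, a directed edge
traversed backwards, or a bidirected edge. -/
inductive EdgeKind : Type
  | fwd | bwd | bidir
deriving DecidableEq

/-- Does the step point into its second endpoint? -/
def EdgeKind.intoSnd : EdgeKind → Bool
  | .fwd => true
  | .bwd => false
  | .bidir => true

/-- Does the step point into its first endpoint? -/
def EdgeKind.intoFst : EdgeKind → Bool
  | .fwd => false
  | .bwd => true
  | .bidir => true

/-- A (possibly self-intersecting) path from `u` to `v` in the mixed graph `(d, b)`. -/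
structure MPath {n : ℕ} (d b : Dir n) (u v : Fin n) where
  len : ℕ
  vert : Fin (len + 1) → Fin n
  kind : Fin len → EdgeKind
  first_eq : vert 0 = u
  last_eq : vert (Fin.last len) = v
  valid : ∀ i : Fin len,
    (kind i = .fwd → d (vert i.castSucc) (vert i.succ) = true) ∧
    (kind i = .bwd → d (vert i.succ) (vert i.castSucc) = true) ∧
    (kind i = .bidir → b (vert i.castSucc) (vert i.succ) = true)

/-- Whether the internal vertex at position `i` of a path is a collider. -/
def MPath.colliderAt {n : ℕ} {d b : Dir n} {u v : Fin n} (π : MPath d b u v)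
    (i : ℕ) (h1 : 0 < i) (h2 : i < π.len) : Bool :=
  (π.kind ⟨i - 1, by omega⟩).intoSnd && (π.kind ⟨i, h2⟩).intoFst

/-- A path is active given a conditioning set `Z` if every non-collider on it avoids `Z`
and every collider on it is in `Z` or has a descendant in `Z`. -/
def MPath.Active {n : ℕ} {d b : Dir n} {u v : Fin n} (π : MPath d b u v)
    (Z : Finset (Fin n)) : Prop :=
  ∀ (i : ℕ) (h1 : 0 < i) (h2 : i < π.len),
    (π.colliderAt i h1 h2 = true →
      ∃ x ∈ Z, Reach d (π.vert ⟨i, by omega⟩) x) ∧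
    (π.colliderAt i h1 h2 = false →
      π.vert ⟨i, by omega⟩ ∉ Z)

/-- d-connection given a conditioning set. -/
def DConn {n : ℕ} (d b : Dir n) (u v : Fin n) (Z : Finset (Fin n)) : Prop :=
  ∃ π : MPath d b u v, π.Active Z

/-- Markov equivalence of two mixed graphs: the same d-connection relations. -/
def MarkovEquiv {n : ℕ} (d b d' b' : Dir n) : Prop :=
  ∀ (u v : Fin n) (Z : Finset (Fin n)), u ≠ v → u ∉ Z → v ∉ Z →
    (DConn d b u v Z ↔ DConn d' b' u v Z)

/-- The empty bidirected part: a purely directed graph. -/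
def noBi (n : ℕ) : Dir n := fun _ _ => false

/-- Markov equivalence for purely directed graphs. -/
def MarkovEquivD {n : ℕ} (d d' : Dir n) : Prop :=
  MarkovEquiv d (noBi n) d' (noBi n)

/-- The Markov equivalence class of a DAG (within DAGs). -/
def MECdag {n : ℕ} (d : Dir n) : Set (Dir n) :=
  {d' | IsDAG d' ∧ MarkovEquivD d d'}

/-- An acyclic directed mixed graph. -/
def IsADMG {n : ℕ} (d b : Dir n) : Prop :=
  IsDAG d ∧ (∀ v w, b v w = b w v) ∧ (∀ v, b v v = false)

/-- The Markov equivalence class of an ADMG (within ADMGs). -/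
def MECadmg {n : ℕ} (d b : Dir n) : Set (Dir n × Dir n) :=
  {G | IsADMG G.1 G.2 ∧ MarkovEquiv d b G.1 G.2}

/-- The Markov equivalence class of a DCG (within DCGs). -/
def MECdcg {n : ℕ} (d : Dir n) : Set (Dir n) :=
  {d' | IsDCG d' ∧ MarkovEquivD d d'}

/-! ### The distribution `D(n,p)` and uniform ADMGs/DCGs -/

/-- The (unnormalized) weight of a DAG under `D(n,p)`. -/
noncomputable def dagWeight {n : ℕ} (p : ℝ) (d : Dir n) : ℝ :=
  (p / (1 - p)) ^ edgeCount d

open scoped Classical in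
/-- Probability of the event `A` under `D(n,p)`. -/
noncomputable def prD (n : ℕ) (p : ℝ) (A : Dir n → Prop) : ℝ :=
  (∑ d : Dir n, if IsDAG d ∧ A d then dagWeight p d else 0) /
    (∑ d : Dir n, if IsDAG d then dagWeight p d else 0)

open scoped Classical in
/-- Expectation of `f` under `D(n,p)`. -/
noncomputable def expD (n : ℕ) (p : ℝ) (f : Dir n → ℝ) : ℝ :=
  (∑ d : Dir n, if IsDAG d then f d * dagWeight p d else 0) /
    (∑ d : Dir n, if IsDAG d then dagWeight p d else 0)

/-- Conditional probability of `A` given `B` under `D(n,p)`. -/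
noncomputable def condPrD (n : ℕ) (p : ℝ) (A B : Dir n → Prop) : ℝ :=
  prD n p (fun d => A d ∧ B d) / prD n p B

open scoped Classical in
/-- Expectation of `f` under the uniform distribution on ADMGs on `n` vertices. -/
noncomputable def expADMG (n : ℕ) (f : Dir n × Dir n → ℝ) : ℝ :=
  (∑ G : Dir n × Dir n, if IsADMG G.1 G.2 then f G else 0) /
    (∑ G : Dir n × Dir n, if IsADMG G.1 G.2 then (1 : ℝ) else 0)

open scoped Classical in
/-- Expectation of `f` under the uniform distribution on DCGs on `n` vertices. -/
noncomputable def expDCG (n : ℕ) (f : Dir n → ℝ) : ℝ :=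
  (∑ d : Dir n, if IsDCG d then f d else 0) /
    (∑ d : Dir n, if IsDCG d then (1 : ℝ) else 0)

open scoped Classical in
/-- Probability of the event `A` under the uniform distribution on DCGs on `n` vertices. -/
noncomputable def prDCG (n : ℕ) (A : Dir n → Prop) : ℝ :=
  (∑ d : Dir n, if IsDCG d ∧ A d then (1 : ℝ) else 0) /
    (∑ d : Dir n, if IsDCG d then (1 : ℝ) else 0)

/-! ### Tower decomposition -/

/-- The sources of `d` within a vertex set `S` (no parents inside `S`). -/
def sourcesIn {n : ℕ} (d : Dir n) (S : Finset (Fin n)) : Finset (Fin n) :=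
  S.filter fun v => ∀ u ∈ S, d u v = false

/-- The vertices remaining after peeling off `k` layers of sources. -/
def remaining {n : ℕ} (d : Dir n) : ℕ → Finset (Fin n)
  | 0 => Finset.univ
  | k + 1 => remaining d k \ sourcesIn d (remaining d k)

/-- The `i`-th layer (1-based) of the tower decomposition of `d`. -/
def towerLayer {n : ℕ} (d : Dir n) (i : ℕ) : Finset (Fin n) :=
  sourcesIn d (remaining d (i - 1))

/-- The 1-based index of the layer containing `v`. -/
def layerIdx {n : ℕ} (d : Dir n) (v : Fin n) : ℕ :=
  ((Finset.range n).filter fun j => v ∈ remaining d j).card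

/-- The tower of a DAG: only the edges between adjacent layers are kept. -/
def tower {n : ℕ} (d : Dir n) : Dir n :=
  fun a c => d a c && decide (layerIdx d c = layerIdx d a + 1)

/-- `h` is the tower vector of `d` (layer sizes, 1-based, and no further layers). -/
def hasTowerVector {n : ℕ} (d : Dir n) (h : List ℕ) : Prop :=
  (∀ i : Fin h.length, (towerLayer d (i.val + 1)).card = h.get i) ∧
    towerLayer d (h.length + 1) = ∅

/-- `H` is the tower decomposition of `d`. -/
def hasTowerDecomp {n : ℕ} (d : Dir n) (H : List (Finset (Fin n))) : Prop :=
  (∀ i : Fin H.length, towerLayer d (i.val + 1) = H.get i) ∧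
    towerLayer d (H.length + 1) = ∅

/-- The weight `w(h)` of a tower vector `h = (h_1, …, h_s)`. -/
noncomputable def towerWeight (p : ℝ) (h : List ℕ) : ℝ :=
  (Nat.multinomial Finset.univ (fun i : Fin h.length => h.get i) : ℝ) *
    ∏ k ∈ Finset.Icc 2 h.length,
      (1 - (1 - p) ^ h.getD (k - 2) 0) ^ h.getD (k - 1) 0 /
        (1 - p) ^ (h.getD (k - 1) 0 * ∑ i ∈ Finset.range (k - 1), h.getD i 0)

/-! ### Edge reversal and deletion -/

/-- Reverse the edge `v → w`. -/
def reverseEdge {n : ℕ} (d : Dir n) (v w : Fin n) : Dir n :=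
  fun a c => if a = v ∧ c = w then false else if a = w ∧ c = v then true else d a c

/-- Delete the edge `v → w`. -/
def deleteEdge {n : ℕ} (d : Dir n) (v w : Fin n) : Dir n :=
  fun a c => if a = v ∧ c = w then false else d a c

/-- The edge `v → w` of a DAG is reversible: reversing it yields a Markov-equivalent DAG. -/
def Reversible {n : ℕ} (d : Dir n) (v w : Fin n) : Prop :=
  d v w = true ∧ IsDAG (reverseEdge d v w) ∧ MarkovEquivD d (reverseEdge d v w)

/-- `d` has a matching of reversible layer-2-edges of size at least `m`. -/
def hasRevL2Matching {n : ℕ} (d : Dir n) (m : ℝ) : Prop :=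
  ∃ S : Finset (Fin n × Fin n),
    (∀ e ∈ S, Reversible d e.1 e.2 ∧ e.2 ∈ towerLayer d 2) ∧
    (∀ e ∈ S, ∀ e' ∈ S, e ≠ e' →
      e.1 ≠ e'.1 ∧ e.1 ≠ e'.2 ∧ e.2 ≠ e'.1 ∧ e.2 ≠ e'.2) ∧
    m ≤ (S.card : ℝ)

/-! ### Cycles and the `Reverse` construction -/

/-- Cyclic successor in `Fin k`. -/
def cycSucc {k : ℕ} (i : Fin k) : Fin k :=
  ⟨(i.val + 1) % k, Nat.mod_lt _ i.pos⟩

/-- The reversed parametrization of a cycle. -/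
def cycRev {n k : ℕ} (c : Fin k → Fin n) : Fin k → Fin n :=
  fun i => c ⟨(k - i.val) % k, Nat.mod_lt _ i.pos⟩

/-- `c` lists the (distinct) vertices of a directed cycle of `d`, in order. -/
def IsCycle {n k : ℕ} (d : Dir n) (c : Fin k → Fin n) : Prop :=
  Function.Injective c ∧ ∀ i, d (c i) (c (cycSucc i)) = true

/-- The `Reverse(G, C)` construction: reverse the cycle `c` and redirect every edge
`w → v_i` with `w ∈ Pa(v_i) \ {v_{i-1}}` to `w → v_{i-1}`. -/
def reverseCycle {n k : ℕ} (d : Dir n) (c : Fin k → Fin n) : Dir n :=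
  fun a e =>
    decide ((∃ j : Fin k, e = c j ∧
        (a = c (cycSucc j) ∨ (d a (c (cycSucc j)) = true ∧ a ≠ c j))) ∨
      ((∀ j : Fin k, e ≠ c j) ∧ d a e = true))

/-- A vertex triple induces exactly a directed 3-cycle. -/
def induces3Cycle {n : ℕ} (d : Dir n) (W : Finset (Fin n)) : Prop :=
  ∃ a b c : Fin n, W = {a, b, c} ∧ a ≠ b ∧ a ≠ c ∧ b ≠ c ∧
    d a b = true ∧ d b c = true ∧ d c a = true ∧
    d b a = false ∧ d c b = false ∧ d a c = false

/-! ### Active walks and moralization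

Two graphs whose families `{w} ∪ Pa(w)` agree up to relabelling have the same ancestral sets and the
same moral graphs on them; separation in these moral graphs characterizes d-separation. -/

/-- `x` belongs to the family of `w`: it is `w` itself or a parent of `w`. -/
def Fam {n : ℕ} (d : Dir n) (w x : Fin n) : Prop :=
  x = w ∨ d x w = true

/-- `x` is an ancestor of `Z`. -/
def AncZ {n : ℕ} (d : Dir n) (Z : Finset (Fin n)) (x : Fin n) : Prop :=
  ∃ z ∈ Z, Reach d x z

/-- `x` is an ancestor of `u`, of `v` or of `Z`. -/
def Anc {n : ℕ} (d : Dir n) (u v : Fin n) (Z : Finset (Fin n)) (x : Fin n) : Prop :=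
  Reach d x u ∨ Reach d x v ∨ AncZ d Z x

/-- `ActiveWalk d Z u x f`: there is an active walk from `u` to `x` whose last edge points into `x`
exactly when `f = true` (the empty walk has `f = false`). -/
inductive ActiveWalk {n : ℕ} (d : Dir n) (Z : Finset (Fin n)) (u : Fin n) : Fin n → Bool → Prop
  | nil : ActiveWalk d Z u u false
  | fwd {x y : Fin n} {f : Bool} : ActiveWalk d Z u x f → x ∉ Z → d x y = true →
      ActiveWalk d Z u y true
  | bwd {x y : Fin n} : ActiveWalk d Z u x false → x ∉ Z → d y x = true →
      ActiveWalk d Z u y false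
  | collider {x y : Fin n} : ActiveWalk d Z u x true → AncZ d Z x → d y x = true →
      ActiveWalk d Z u y false

/-- Adjacency in the moral graph on the ancestors of `u`, `v` and `Z`, leaving from outside `Z`. -/
def MoralStep {n : ℕ} (d : Dir n) (u v : Fin n) (Z : Finset (Fin n)) (x y : Fin n) : Prop :=
  x ∉ Z ∧ ∃ w, Anc d u v Z w ∧ Fam d w x ∧ Fam d w y

section Walks

variable {n : ℕ} {d d' : Dir n} {Z : Finset (Fin n)} {u v x y : Fin n} {f : Bool}

theorem AncZ.head (hy : AncZ d Z y) (h : d x y = true) : AncZ d Z x := by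
  obtain ⟨z, hz, hr⟩ := hy
  exact ⟨z, hz, hr.head h⟩

theorem Anc.of_reach (hy : Anc d u v Z y) (h : Reach d x y) : Anc d u v Z x := by
  rcases hy with hy | hy | ⟨z, hz, hy⟩
  · exact .inl (h.trans hy)
  · exact .inr (.inl (h.trans hy))
  · exact .inr (.inr ⟨z, hz, h.trans hy⟩)

theorem Anc.head (hy : Anc d u v Z y) (h : d x y = true) : Anc d u v Z x :=
  hy.of_reach (.single h)

theorem ActiveWalk.of_reach_start (h : Reach d x u) (hx : ¬ AncZ d Z x) :
    ActiveWalk d Z u x false := by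
  induction h using Relation.ReflTransGen.head_induction_on with
  | refl => exact .nil
  | head hab _ ih =>
    have hb := fun hb => hx (AncZ.head hb hab)
    exact (ih hb).bwd (fun hz => hb ⟨_, hz, .refl⟩) hab

theorem ActiveWalk.extend_reach (h : Reach d x v) (hx : ¬ AncZ d Z x)
    (hw : ∃ f, ActiveWalk d Z u x f) : ∃ f, ActiveWalk d Z u v f := by
  induction h using Relation.ReflTransGen.head_induction_on with
  | refl => exact hw
  | head hab _ ih =>
    obtain ⟨f, hw⟩ := hw
    exact ih (fun hb => hx (hb.head hab)) ⟨true, hw.fwd (fun hz => hx ⟨_, hz, .refl⟩) hab⟩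

theorem ActiveWalk.bwd_of_into (hw : ActiveWalk d Z u x true) (hx : Anc d u v Z x)
    (h : d y x = true) : (∃ f, ActiveWalk d Z u v f) ∨ ActiveWalk d Z u y false := by
  by_cases hz : AncZ d Z x
  · exact .inr (hw.collider hz h)
  rcases hx with hx | hx | hx
  · exact .inr ((of_reach_start hx hz).bwd (fun h => hz ⟨_, h, .refl⟩) h)
  · exact .inl (extend_reach hx hz ⟨_, hw⟩)
  · exact absurd hx hz

theorem ActiveWalk.moral (hw : ActiveWalk d Z u x f) :
    (f = false → Anc d u v Z x ∧ Relation.ReflTransGen (MoralStep d u v Z) u x) ∧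
    (f = true → ∃ p, p ∉ Z ∧ d p x = true ∧
      (Anc d u v Z x → Relation.ReflTransGen (MoralStep d u v Z) u p)) := by
  induction hw with
  | nil => exact ⟨fun _ => ⟨.inl .refl, .refl⟩, nofun⟩
  | @fwd x y f _ hx hxy ih =>
    refine ⟨nofun, fun _ => ⟨x, hx, hxy, fun hy => ?_⟩⟩
    cases f with
    | false => exact (ih.1 rfl).2
    | true =>
      obtain ⟨p, hp, hpx, hc⟩ := ih.2 rfl
      have hxA := hy.head hxy
      exact (hc hxA).tail ⟨hp, x, hxA, .inr hpx, .inl rfl⟩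
  | @bwd x y _ hx hyx ih =>
    obtain ⟨hxA, hc⟩ := ih.1 rfl
    exact ⟨fun _ => ⟨hxA.head hyx, hc.tail ⟨hx, x, hxA, .inl rfl, .inr hyx⟩⟩, nofun⟩
  | @collider x y _ hx hyx ih =>
    obtain ⟨p, hp, hpx, hc⟩ := ih.2 rfl
    have hxA : Anc d u v Z x := .inr (.inr hx)
    exact ⟨fun _ => ⟨hxA.head hyx, (hc hxA).tail ⟨hp, x, hxA, .inr hpx, .inr hyx⟩⟩, nofun⟩

theorem ActiveWalk.moral_connected (hw : ActiveWalk d Z u v f) :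
    Relation.ReflTransGen (MoralStep d u v Z) u v := by
  have hv : Anc d u v Z v := .inr (.inl .refl)
  cases f with
  | false => exact (hw.moral.1 rfl).2
  | true =>
    obtain ⟨p, hp, hpv, hc⟩ := hw.moral.2 rfl
    exact (hc hv).tail ⟨hp, v, hv, .inr hpv, .inl rfl⟩

theorem exists_activeWalk_of_moral (h : Relation.ReflTransGen (MoralStep d u v Z) u x) :
    (∃ f, ActiveWalk d Z u v f) ∨ ∃ f, ActiveWalk d Z u x f := by
  induction h with
  | refl => exact .inr ⟨_, .nil⟩
  | @tail x y _ hxy ih =>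
    rcases ih with ih | ⟨f, hw⟩
    · exact .inl ih
    obtain ⟨hx, w, hwA, hxw, hyw⟩ := hxy
    rcases hxw with rfl | hxw <;> rcases hyw with rfl | hyw
    · exact .inr ⟨_, hw⟩
    · cases f with
      | false => exact .inr ⟨_, hw.bwd hx hyw⟩
      | true => exact (hw.bwd_of_into hwA hyw).imp_right fun h => ⟨_, h⟩
    · exact .inr ⟨_, hw.fwd hx hxw⟩
    · exact ((hw.fwd hx hxw).bwd_of_into hwA hyw).imp_right fun h => ⟨_, h⟩

/-- d-connection is equivalent to connection outside `Z` in the moral graph. -/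
theorem exists_activeWalk_iff_moral :
    (∃ f, ActiveWalk d Z u v f) ↔ Relation.ReflTransGen (MoralStep d u v Z) u v :=
  ⟨fun ⟨_, hw⟩ => hw.moral_connected, fun h => (exists_activeWalk_of_moral h).elim id id⟩

theorem exists_activeWalk_of_dConn (hu : u ∉ Z) (h : DConn d (noBi n) u v Z) :
    ∃ f, ActiveWalk d Z u v f := by
  obtain ⟨π, hπ⟩ := h
  have key : ∀ (i : ℕ) (hi : i < π.len + 1), ∃ f, ActiveWalk d Z u (π.vert ⟨i, hi⟩) f ∧
      (i = 0 → f = false) ∧ ∀ h0 : 0 < i, f = (π.kind ⟨i - 1, by omega⟩).intoSnd := by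
    intro i
    induction i with
    | zero =>
      have hnil : ActiveWalk d Z u (π.vert 0) false := by
        rw [π.first_eq]
        exact .nil
      exact fun _ => ⟨false, hnil, fun _ => rfl, fun h => absurd h (lt_irrefl 0)⟩
    | succ i ih =>
      intro hi
      obtain ⟨f, hw, hf0, hf⟩ := ih (by omega)
      have hi' : i < π.len := by omega
      have hnon : (f = false ∨ (π.kind ⟨i, hi'⟩).intoFst = false) →
          π.vert ⟨i, by omega⟩ ∉ Z := by
        intro h
        rcases Nat.eq_zero_or_pos i with rfl | h0
        · exact fun hz => hu (π.first_eq ▸ hz)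
        · refine (hπ i h0 hi').2 ?_
          rw [MPath.colliderAt, ← hf h0]
          rcases h with h | h <;> simp [h]
      have hval := π.valid ⟨i, hi'⟩
      cases hk : π.kind ⟨i, hi'⟩ with
      | fwd =>
        exact ⟨true, hw.fwd (hnon (.inr (by rw [hk]; rfl))) (hval.1 hk), nofun,
          fun _ => by simp [hk, EdgeKind.intoSnd]⟩
      | bidir => simpa [noBi] using hval.2.2 hk
      | bwd =>
        refine ⟨false, ?_, fun _ => rfl, fun _ => by simp [hk, EdgeKind.intoSnd]⟩
        cases f with
        | false => exact hw.bwd (hnon (.inl rfl)) (hval.2.1 hk)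
        | true =>
          have h0 : 0 < i := Nat.pos_of_ne_zero fun h => by simpa using hf0 h
          refine hw.collider ((hπ i h0 hi').1 ?_) (hval.2.1 hk)
          rw [MPath.colliderAt, ← hf h0, hk]
          rfl
  obtain ⟨f, hw, _⟩ := key π.len (by omega)
  exact ⟨f, π.last_eq ▸ hw⟩

/-- Append one edge at the end of a path. -/
def MPath.snoc {b : Dir n} (π : MPath d b u x) (y : Fin n) (k : EdgeKind)
    (hk : (k = .fwd → d x y = true) ∧ (k = .bwd → d y x = true) ∧ (k = .bidir → b x y = true)) :
    MPath d b u y where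
  len := π.len + 1
  vert i := if h : i.val < π.len + 1 then π.vert ⟨i, h⟩ else y
  kind i := if h : i.val < π.len then π.kind ⟨i, h⟩ else k
  first_eq := by simpa using π.first_eq
  last_eq := by simp
  valid i := by
    by_cases h : i.val < π.len
    · simpa [h, Nat.lt_succ_of_lt h] using π.valid ⟨i, h⟩
    · have hi : i.val = π.len := by omega
      simpa [hi, show π.vert ⟨π.len, by omega⟩ = x from π.last_eq] using hk

theorem MPath.snoc_active {b : Dir n} {π : MPath d b u x} {k : EdgeKind}
    {hk : (k = .fwd → d x y = true) ∧ (k = .bwd → d y x = true) ∧ (k = .bidir → b x y = true)}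
    (hπ : π.Active Z)
    (hx : ∀ h : 0 < π.len,
      (((π.kind ⟨π.len - 1, by omega⟩).intoSnd && k.intoFst) = true → AncZ d Z x) ∧
      (((π.kind ⟨π.len - 1, by omega⟩).intoSnd && k.intoFst) = false → x ∉ Z)) :
    (π.snoc y k hk).Active Z := by
  intro i h1 h2
  have h2' : i < π.len + 1 := h2
  by_cases h : i < π.len
  · have := hπ i h1 h
    have h' : i - 1 < π.len := by omega
    simpa [MPath.colliderAt, MPath.snoc, h, h', h2'] using this
  · obtain rfl : i = π.len := by omega
    have h' : π.len - 1 < π.len := by omega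
    have hlast : π.vert ⟨π.len, by omega⟩ = x := π.last_eq
    simpa [MPath.colliderAt, MPath.snoc, h', hlast, AncZ] using hx h1

theorem ActiveWalk.exists_mPath (hw : ActiveWalk d Z u x f) :
    ∃ π : MPath d (noBi n) u x, π.Active Z ∧
      ∀ h : 0 < π.len, f = (π.kind ⟨π.len - 1, by omega⟩).intoSnd := by
  induction hw with
  | nil =>
    exact ⟨⟨0, fun _ => u, Fin.elim0, rfl, rfl, fun i => i.elim0⟩,
      fun i _ h => absurd h (Nat.not_lt_zero i), fun h => absurd h (lt_irrefl 0)⟩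
  | @fwd x y f _ hx hxy ih =>
    obtain ⟨π, hπ, hf⟩ := ih
    refine ⟨π.snoc y .fwd ⟨fun _ => hxy, nofun, nofun⟩, MPath.snoc_active hπ fun h => ?_, fun _ => ?_⟩
    · simp [EdgeKind.intoFst, hx]
    · simp [MPath.snoc, EdgeKind.intoSnd]
  | @bwd x y _ hx hyx ih =>
    obtain ⟨π, hπ, hf⟩ := ih
    refine ⟨π.snoc y .bwd ⟨nofun, fun _ => hyx, nofun⟩, MPath.snoc_active hπ fun h => ?_, fun _ => ?_⟩
    · simp [← hf h, hx]
    · simp [MPath.snoc, EdgeKind.intoSnd]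
  | @collider x y _ hx hyx ih =>
    obtain ⟨π, hπ, hf⟩ := ih
    refine ⟨π.snoc y .bwd ⟨nofun, fun _ => hyx, nofun⟩, MPath.snoc_active hπ fun h => ?_, fun _ => ?_⟩
    · simp [← hf h, EdgeKind.intoFst, hx]
    · simp [MPath.snoc, EdgeKind.intoSnd]

theorem dConn_iff_moral (hu : u ∉ Z) :
    DConn d (noBi n) u v Z ↔ Relation.ReflTransGen (MoralStep d u v Z) u v := by
  rw [← exists_activeWalk_iff_moral]
  refine ⟨exists_activeWalk_of_dConn hu, fun ⟨f, hw⟩ => ?_⟩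
  obtain ⟨π, hπ, _⟩ := hw.exists_mPath
  exact ⟨π, hπ⟩

/-- If every family of `d` is contained in the family in `d'` of some ancestor, then
d-connection in `d` implies d-connection in `d'`. -/
theorem DConn.of_fam (h : ∀ w, ∃ w', (∀ x, Fam d w x → Fam d' w' x) ∧ Reach d' w' w)
    (hu : u ∉ Z) (hc : DConn d (noBi n) u v Z) : DConn d' (noBi n) u v Z := by
  have hreach : ∀ {x y}, Reach d x y → Reach d' x y := by
    intro x y hxy
    induction hxy with
    | refl => exact .refl
    | @tail y z _ hyz ih =>
      obtain ⟨w, hw, hwz⟩ := h z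
      rcases hw y (.inr hyz) with rfl | hyw
      · exact ih.trans hwz
      · exact (ih.tail hyw).trans hwz
  have hanc : ∀ {w}, Anc d u v Z w → Anc d' u v Z w := by
    rintro w (hw | hw | ⟨z, hz, hw⟩)
    · exact .inl (hreach hw)
    · exact .inr (.inl (hreach hw))
    · exact .inr (.inr ⟨z, hz, hreach hw⟩)
  rw [dConn_iff_moral hu] at hc ⊢
  refine Relation.ReflTransGen.mono (fun x y hxy => ?_) _ _ hc
  obtain ⟨hx, w, hwA, hxw, hyw⟩ := hxy
  obtain ⟨w', hw', hr⟩ := h w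
  exact ⟨hx, w', (hanc hwA).of_reach hr, hw' x hxw, hw' y hyw⟩

end Walks

section Cycles

variable {n k : ℕ} {d : Dir n} {c : Fin k → Fin n}

theorem cycSucc_surjective : Function.Surjective (cycSucc (k := k)) := by
  intro j
  have hj := j.isLt
  refine ⟨⟨(j.val + k - 1) % k, Nat.mod_lt _ j.pos⟩, Fin.ext ?_⟩
  simp only [cycSucc, Nat.mod_add_mod]
  rw [show j.val + k - 1 + 1 = j.val + k by omega, Nat.add_mod_right, Nat.mod_eq_of_lt hj]

theorem reflTransGen_cycSucc (i j : Fin k) :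
    Relation.ReflTransGen (fun a b : Fin k => b = cycSucc a) i j := by
  have key : ∀ m : ℕ, Relation.ReflTransGen (fun a b : Fin k => b = cycSucc a) i
      ⟨(i.val + m) % k, Nat.mod_lt _ i.pos⟩ := by
    intro m
    induction m with
    | zero => simpa [Nat.mod_eq_of_lt i.isLt] using Relation.ReflTransGen.refl
    | succ m ih => exact ih.tail (Fin.ext (by simp [cycSucc, Nat.add_assoc]))
  have hi := i.isLt
  convert key (j.val + k - i.val) using 1
  refine Fin.ext ?_
  simp only
  rw [show i.val + (j.val + k - i.val) = j.val + k by omega, Nat.add_mod_right,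
    Nat.mod_eq_of_lt j.isLt]

theorem IsCycle.reach (hc : IsCycle d c) (i j : Fin k) : Reach d (c i) (c j) :=
  (reflTransGen_cycSucc i j).lift c fun a _ h => h ▸ hc.2 a

theorem reverseCycle_succ (i : Fin k) : reverseCycle d c (c (cycSucc i)) (c i) = true :=
  decide_eq_true (.inl ⟨i, rfl, .inl rfl⟩)

theorem reach_reverseCycle (i j : Fin k) : Reach (reverseCycle d c) (c i) (c j) :=
  (reflTransGen_cycSucc j i).swap.lift c fun _ b h => h ▸ reverseCycle_succ b

theorem fam_reverseCycle_of_fam (w : Fin n) :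
    ∃ w', (∀ x, Fam d w x → Fam (reverseCycle d c) w' x) ∧ Reach (reverseCycle d c) w' w := by
  by_cases hw : ∃ j, w = c j
  · obtain ⟨j, rfl⟩ := hw
    obtain ⟨i, rfl⟩ := cycSucc_surjective j
    refine ⟨c i, ?_, reach_reverseCycle _ _⟩
    rintro x (rfl | hx)
    · exact .inr (reverseCycle_succ i)
    · by_cases hxi : x = c i
      · exact .inl hxi
      · exact .inr (decide_eq_true (.inl ⟨i, rfl, .inr ⟨hx, hxi⟩⟩))
  · exact ⟨w, fun x hx => hx.imp_right fun hx =>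
      decide_eq_true (.inr ⟨not_exists.1 hw, hx⟩), .refl⟩

theorem IsCycle.fam_of_fam_reverseCycle (hc : IsCycle d c) (w : Fin n) :
    ∃ w', (∀ x, Fam (reverseCycle d c) w x → Fam d w' x) ∧ Reach d w' w := by
  by_cases hw : ∃ j, w = c j
  · obtain ⟨i, hi⟩ := hw
    refine ⟨c (cycSucc i), ?_, hi ▸ hc.reach _ _⟩
    rintro x (rfl | hx)
    · exact .inr (hi ▸ hc.2 i)
    · rcases of_decide_eq_true hx with ⟨j, hj, hx⟩ | ⟨hn, _⟩
      · obtain rfl := hc.1 (hi.symm.trans hj)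
        exact hx.imp_right And.left
      · exact absurd hi (hn i)
  · refine ⟨w, fun x hx => hx.imp_right fun hx => ?_, .refl⟩
    rcases of_decide_eq_true hx with ⟨j, hj, _⟩ | ⟨_, hx⟩
    · exact absurd ⟨j, hj⟩ hw
    · exact hx

end Cycles

/-- Proposition 5.2: for a DCG `d` containing a directed cycle `c`,
the graph `Reverse(d, c)` is Markov equivalent to `d`. -/
theorem reverse_cycle_markov_equiv (n k : ℕ) (hk : 2 ≤ k)
    (d : Dir n) (hd : IsDCG d)
    (c : Fin k → Fin n) (hc : IsCycle d c) :
    MarkovEquivD d (reverseCycle d c) := by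
  intro u v Z _ hu _
  exact ⟨DConn.of_fam fam_reverseCycle_of_fam hu, DConn.of_fam hc.fam_of_fam_reverseCycle hu⟩

end CausalMEC
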